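/- arXiv:2309.13769 — 6 statements merged into one kernel-verified Lean document; each statement's English description precedes it below -/
import Mathlib

section
/- Let S be a commutative ring and let s₁, …, sₙ ∈ S be a regular sequence, and let I = (s₁, …, sₙ) be the ideal they generate. Then S is I-adically complete if and only if S is sᵢ-adically complete (i.e. complete with respect to the ideal (sᵢ)) for every i = 1, …, n. -/
open scoped Pointwise

open RingTheory.Sequence in
lemma wr_ext {R : Type*} [CommRing R] (rs : List R) : ∀ {A B C : Type _}
    [AddCommGroup A] [AddCommGroup B] [AddCommGroup C] [Module R A] [Module R B] [Module R C]
    (f : A →ₗ[R] B) (g : B →ₗ[R] C), Function.Injective f → Function.Exact f g →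
    Function.Surjective g → IsWeaklyRegular A rs → IsWeaklyRegular C rs →
    IsWeaklyRegular B rs := by
  induction rs with
  | nil => intros; exact IsWeaklyRegular.nil R _
  | cons r rs ih =>
    intro A B C _ _ _ _ _ _ f g hf hfg hg hA hC
    rw [isWeaklyRegular_cons_iff] at hA hC ⊢
    have hCr := hC.1
    rw [isSMulRegular_iff_right_eq_zero_of_smul] at hCr
    have hAr := hA.1
    rw [isSMulRegular_iff_right_eq_zero_of_smul] at hAr
    refine ⟨?_, ih (QuotSMulTop.map r f) (QuotSMulTop.map r g) ?_
      (QuotSMulTop.map_exact r hfg hg) (QuotSMulTop.map_surjective r hg) hA.2 hC.2⟩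
    · rw [isSMulRegular_iff_right_eq_zero_of_smul]
      intro b hb
      have h1 : g b = 0 := hCr _ (by rw [← map_smul, hb, map_zero])
      obtain ⟨a, rfl⟩ := (hfg b).1 h1
      have : r • a = 0 := hf (by rw [map_smul, hb, map_zero])
      rw [hAr _ this, map_zero]
    · rw [injective_iff_map_eq_zero]
      intro a ha
      obtain ⟨a, rfl⟩ := Submodule.Quotient.mk_surjective _ a
      rw [QuotSMulTop.map_apply_mk, Submodule.Quotient.mk_eq_zero,
        Submodule.mem_smul_pointwise_iff_exists] at ha
      obtain ⟨b, -, hb⟩ := ha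
      have h1 : g b = 0 := hCr _ (by rw [← map_smul, hb, hfg.apply_apply_eq_zero])
      obtain ⟨a', rfl⟩ := (hfg b).1 h1
      rw [Submodule.Quotient.mk_eq_zero, Submodule.mem_smul_pointwise_iff_exists]
      exact ⟨a', trivial, hf (by rw [map_smul, hb])⟩

open RingTheory.Sequence in
lemma wr_pow {R M : Type*} [CommRing R] [AddCommGroup M] [Module R M] (r : R) (rs : List R)
    (h : IsWeaklyRegular M (r :: rs)) (k : ℕ) : IsWeaklyRegular (QuotSMulTop (r ^ k) M) rs := by
  rw [isWeaklyRegular_cons_iff] at h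
  obtain ⟨hr, h⟩ := h
  induction k with
  | zero =>
    have hs : Subsingleton (QuotSMulTop (r ^ 0) M) := by
      rw [Submodule.Quotient.subsingleton_iff]
      simp
    have : Function.Surjective (0 : QuotSMulTop r M →ₗ[R] QuotSMulTop (r ^ 0) M) :=
      fun y => ⟨0, Subsingleton.elim _ _⟩
    constructor
    intro i hi
    have : Subsingleton ((QuotSMulTop (r ^ 0) M) ⧸ (Ideal.ofList (rs.take i) • ⊤ : Submodule R (QuotSMulTop (r ^ 0) M))) :=
      (Submodule.Quotient.mk_surjective _).subsingleton
    exact fun _ _ _ => Subsingleton.elim _ _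
  | succ k ih =>
    have hrk : IsSMulRegular M (r ^ k) := hr.pow k
    let f : QuotSMulTop r M →ₗ[R] QuotSMulTop (r ^ (k + 1)) M :=
      Submodule.mapQ _ _ (LinearMap.lsmul R M (r ^ k)) (by
        intro x hx
        rw [Submodule.mem_smul_pointwise_iff_exists] at hx
        obtain ⟨y, -, rfl⟩ := hx
        rw [Submodule.mem_comap, Submodule.mem_smul_pointwise_iff_exists]
        exact ⟨y, trivial, by simp [pow_succ, mul_smul, smul_comm r]⟩)
    let g : QuotSMulTop (r ^ (k + 1)) M →ₗ[R] QuotSMulTop (r ^ k) M :=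
      Submodule.mapQ _ _ LinearMap.id (by
        intro x hx
        rw [Submodule.mem_smul_pointwise_iff_exists] at hx
        obtain ⟨y, -, rfl⟩ := hx
        rw [Submodule.mem_comap, Submodule.mem_smul_pointwise_iff_exists]
        exact ⟨r • y, trivial, by simp [pow_succ, mul_smul]⟩)
    have hfm : ∀ x : M, f (Submodule.Quotient.mk x) = Submodule.Quotient.mk (r ^ k • x) :=
      fun _ => rfl
    have hgm : ∀ x : M, g (Submodule.Quotient.mk x) = Submodule.Quotient.mk x :=
      fun _ => rfl
    refine wr_ext rs f g ?_ ?_ ?_ h ih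
    · rw [injective_iff_map_eq_zero]
      intro a ha
      obtain ⟨a, rfl⟩ := Submodule.Quotient.mk_surjective _ a
      rw [hfm, Submodule.Quotient.mk_eq_zero, Submodule.mem_smul_pointwise_iff_exists] at ha
      obtain ⟨b, -, hb⟩ := ha
      rw [Submodule.Quotient.mk_eq_zero, Submodule.mem_smul_pointwise_iff_exists]
      exact ⟨b, trivial, hrk (by simpa [pow_succ, mul_smul] using hb)⟩
    · intro b
      obtain ⟨b, rfl⟩ := Submodule.Quotient.mk_surjective _ b
      rw [hgm, Submodule.Quotient.mk_eq_zero, Submodule.mem_smul_pointwise_iff_exists]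
      constructor
      · rintro ⟨c, -, rfl⟩
        exact ⟨Submodule.Quotient.mk c, rfl⟩
      · rintro ⟨c, hc⟩
        obtain ⟨c, rfl⟩ := Submodule.Quotient.mk_surjective _ c
        rw [hfm, Submodule.Quotient.eq, Submodule.mem_smul_pointwise_iff_exists] at hc
        obtain ⟨d, -, hd⟩ := hc
        exact ⟨c - r • d, trivial, by
          rw [smul_sub, smul_smul, ← pow_succ, hd]; abel⟩
    · intro b
      obtain ⟨b, rfl⟩ := Submodule.Quotient.mk_surjective _ b
      exact ⟨Submodule.Quotient.mk b, rfl⟩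

/-- Elementary form of derived completeness with respect to one element. -/
structure DComp {R : Type*} [CommRing R] (s : R) (M : Type*) [AddCommGroup M] [Module R M] :
    Prop where
  ex : ∀ y : ℕ → M, ∃ x : ℕ → M, ∀ k, x k - s • x (k + 1) = y k
  uniq : ∀ x : ℕ → M, (∀ k, x k = s • x (k + 1)) → ∀ k, x k = 0

lemma DComp.quot {R : Type*} [CommRing R] {s : R} {M : Type*} [AddCommGroup M] [Module R M]
    (h : DComp s M) (t : R) : DComp s (QuotSMulTop t M) where
  ex y := by
    choose y' hy' using fun k => Submodule.Quotient.mk_surjective _ (y k)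
    obtain ⟨x, hx⟩ := h.ex y'
    refine ⟨fun k => Submodule.Quotient.mk (x k), fun k => ?_⟩
    rw [← hy', ← hx]; rfl
  uniq x hx := by
    choose x' hx' using fun k => Submodule.Quotient.mk_surjective _ (x k)
    have : ∀ k, ∃ y, t • y = x' k - s • x' (k + 1) := by
      intro k
      have h1 := hx k
      rw [← hx', ← hx' (k + 1), ← Submodule.Quotient.mk_smul, Submodule.Quotient.eq,
        Submodule.mem_smul_pointwise_iff_exists] at h1
      obtain ⟨y, -, hy⟩ := h1
      exact ⟨y, hy⟩
    choose y hy using this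
    obtain ⟨z, hz⟩ := h.ex y
    intro k
    rw [← hx', Submodule.Quotient.mk_eq_zero, Submodule.mem_smul_pointwise_iff_exists]
    refine ⟨z k, trivial, ?_⟩
    have := h.uniq (fun k => x' k - t • z k) (fun k => by
      have h1 := hy k
      rw [← hz k, smul_sub, smul_comm t s] at h1
      rw [smul_sub, sub_eq_sub_iff_add_eq_add]
      rw [sub_eq_sub_iff_add_eq_add] at h1
      rw [← h1.symm.trans (add_comm _ _)]) k
    exact (sub_eq_zero.1 this).symm

lemma DComp.sep {R : Type*} [CommRing R] {s : R} {M : Type*} [AddCommGroup M] [Module R M]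
    (h : DComp s M) (hs : IsSMulRegular M s) (x : M)
    (hx : ∀ k : ℕ, x ∈ s ^ k • (⊤ : Submodule R M)) : x = 0 := by
  have : ∀ k, ∃ y, s ^ k • y = x := by
    intro k
    obtain ⟨y, -, hy⟩ := (Submodule.mem_smul_pointwise_iff_exists _ _ _).1 (hx k)
    exact ⟨y, hy⟩
  choose y hy using this
  have h0 := h.uniq y (fun k => (hs.pow k) (by
    change s ^ k • y k = s ^ k • s • y (k + 1)
    rw [smul_smul, ← pow_succ, hy, hy])) 0
  rw [← hy 0, h0, smul_zero]

open RingTheory.Sequence in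
lemma sep_list {R : Type*} [CommRing R] (rs : List R) : ∀ {M : Type _}
    [AddCommGroup M] [Module R M], IsWeaklyRegular M rs → (∀ r ∈ rs, DComp r M) →
    ∀ x : M, (∀ k : ℕ, x ∈ (Ideal.ofList rs ^ k • ⊤ : Submodule R M)) → x = 0 := by
  induction rs with
  | nil =>
    intro M _ _ _ _ x hx
    simpa using hx 1
  | cons r rs ih =>
    intro M _ _ hreg hD x hx
    have hr := ((isWeaklyRegular_cons_iff _ _ _).1 hreg).1
    refine (hD r (by simp)).sep hr x fun k => ?_
    rw [← Submodule.Quotient.mk_eq_zero]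
    refine ih (wr_pow r rs hreg k) (fun t ht => (hD t (by simp [ht])).quot _) _ fun m => ?_
    have h1 := hx (k + m)
    have h2 : (Ideal.ofList (r :: rs)) ^ (k + m) ≤
        Ideal.span {r ^ k} ⊔ Ideal.ofList rs ^ m := by
      rw [Ideal.ofList_cons, ← Ideal.span_singleton_pow]
      exact Ideal.sup_pow_add_le_pow_sup_pow
    have h3 := Submodule.smul_mono_left (N := (⊤ : Submodule R M)) h2 h1
    rw [Submodule.sup_smul, Submodule.ideal_span_singleton_smul] at h3
    obtain ⟨a, ha, b, hb, rfl⟩ := Submodule.mem_sup.1 h3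
    rw [Submodule.Quotient.mk_add, (Submodule.Quotient.mk_eq_zero _).2 ha, zero_add]
    have h4 := Submodule.mem_map_of_mem (f := (r ^ k • (⊤ : Submodule R M)).mkQ) hb
    rw [Submodule.map_smul''] at h4
    exact Submodule.smul_mono le_rfl le_top h4

lemma prec_sum {R : Type*} [CommRing R] {I : Ideal R} (h : IsPrecomplete I R) (u : ℕ → R)
    (hu : ∀ m, u m ∈ I ^ m) : ∃ U, ∀ m, U - ∑ k ∈ Finset.range m, u k ∈ I ^ m := by
  obtain ⟨L, hL⟩ := h.prec (f := fun m => ∑ k ∈ Finset.range m, u k) (by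
    intro m n hmn
    rw [SModEq.comm, SModEq.sub_mem, smul_eq_mul, Ideal.mul_top,
      ← Finset.sum_Ico_eq_sub _ hmn]
    exact Ideal.sum_mem _ fun k hk => Ideal.pow_le_pow_right (Finset.mem_Ico.1 hk).1 (hu k))
  refine ⟨L, fun m => ?_⟩
  have := (hL m).symm
  rwa [SModEq.sub_mem, smul_eq_mul, Ideal.mul_top] at this

lemma prec_of_seq {R : Type*} [CommRing R] {I : Ideal R}
    (h : ∀ f : ℕ → R, (∀ m n, m ≤ n → f n - f m ∈ I ^ m) → ∃ L, ∀ m, L - f m ∈ I ^ m) :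
    IsPrecomplete I R := by
  refine ⟨fun f hf => ?_⟩
  obtain ⟨L, hL⟩ := h f (fun m n hmn => by
    have := (hf hmn).symm
    rwa [SModEq.sub_mem, smul_eq_mul, Ideal.mul_top] at this)
  refine ⟨L, fun m => ?_⟩
  rw [SModEq.comm, SModEq.sub_mem, smul_eq_mul, Ideal.mul_top]
  exact hL m

lemma haus_mem {R : Type*} [CommRing R] {I : Ideal R} (h : IsHausdorff I R) (x : R)
    (hx : ∀ m, x ∈ I ^ m) : x = 0 :=
  h.haus x fun m => by
    rw [SModEq.zero, smul_eq_mul, Ideal.mul_top]; exact hx m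

lemma prec_sup {R : Type*} [CommRing R] {I J : Ideal R} (hI : IsPrecomplete I R)
    (hJ : IsPrecomplete J R) : IsPrecomplete (I ⊔ J) R := by
  refine prec_of_seq fun f hf => ?_
  have : ∀ m, ∃ u ∈ I ^ m, ∃ v ∈ J ^ m, u + v = f ((m + 1) + (m + 1)) - f (m + m) := fun m =>
    Submodule.mem_sup.1 (Ideal.sup_pow_add_le_pow_sup_pow (hf (m + m) _ (by omega)))
  choose u hu v hv huv using this
  obtain ⟨U, hU⟩ := prec_sum hI u hu
  obtain ⟨V, hV⟩ := prec_sum hJ v hv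
  refine ⟨f 0 + U + V, fun m => ?_⟩
  have hs : ∑ k ∈ Finset.range m, u k + ∑ k ∈ Finset.range m, v k = f (m + m) - f 0 := by
    rw [← Finset.sum_add_distrib, Finset.sum_congr rfl (fun k _ => huv k),
      Finset.sum_range_sub (fun k => f (k + k))]
  have e : f 0 + U + V - f m = (U - ∑ k ∈ Finset.range m, u k) +
      (V - ∑ k ∈ Finset.range m, v k) + (f (m + m) - f m) := by
    linear_combination hs
  rw [e]
  exact add_mem (add_mem (Ideal.pow_right_mono le_sup_left _ (hU m))
    (Ideal.pow_right_mono le_sup_right _ (hV m))) (hf _ _ (by omega))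

lemma prec_list {R : Type*} [CommRing R] (rs : List R)
    (h : ∀ r ∈ rs, IsPrecomplete (Ideal.span {r}) R) : IsPrecomplete (Ideal.ofList rs) R := by
  induction rs with
  | nil => rw [Ideal.ofList_nil]; infer_instance
  | cons r rs ih =>
    rw [Ideal.ofList_cons]
    exact prec_sup (h r (by simp)) (ih fun t ht => h t (by simp [ht]))

/-- Convergence of power series in an element of the ideal. -/
lemma geom_sum {R : Type*} [CommRing R] {I : Ideal R} (h : IsAdicComplete I R) {s : R}
    (hs : s ∈ I) (y : ℕ → R) : ∃ x : ℕ → R, (∀ k, x k - s * x (k + 1) = y k) ∧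
      ∀ k m, x k - ∑ j ∈ Finset.range m, s ^ j * y (k + j) ∈ I ^ m := by
  have := fun k => prec_sum h.toIsPrecomplete (fun j => s ^ j * y (k + j))
    (fun m => Ideal.mul_mem_right _ _ (Ideal.pow_mem_pow hs m))
  choose x hx using this
  refine ⟨x, fun k => ?_, hx⟩
  rw [← sub_eq_zero]
  refine haus_mem h.toIsHausdorff _ fun m => ?_
  have h1 := Ideal.pow_le_pow_right (Nat.le_succ m) (hx k (m + 1))
  have h2 := Ideal.mul_mem_left _ s (hx (k + 1) m)
  have e : ∑ j ∈ Finset.range (m + 1), s ^ j * y (k + j) =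
      s * ∑ j ∈ Finset.range m, s ^ j * y (k + 1 + j) + y k := by
    rw [Finset.sum_range_succ', Finset.mul_sum]
    congr 1
    · refine Finset.sum_congr rfl fun j _ => ?_
      rw [show k + (j + 1) = k + 1 + j by omega]; ring
    · simp
  rw [e] at h1
  convert sub_mem h1 h2 using 1
  ring

lemma dcomp_of_complete {R : Type*} [CommRing R] {s : R}
    (h : IsAdicComplete (Ideal.span {s}) R) : DComp s R where
  ex y := by
    obtain ⟨x, hx, -⟩ := geom_sum h (Ideal.mem_span_singleton_self s) y
    exact ⟨x, hx⟩
  uniq x hx k := by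
    refine haus_mem h.toIsHausdorff _ fun m => ?_
    rw [Ideal.span_singleton_pow, Ideal.mem_span_singleton]
    refine ⟨x (k + m), ?_⟩
    induction m with
    | zero => simp
    | succ m ih => rw [ih, hx (k + m), smul_eq_mul, pow_succ, mul_assoc, add_assoc]

lemma complete_single {R : Type*} [CommRing R] {I : Ideal R} (h : IsAdicComplete I R) {s : R}
    (hs : s ∈ I) : IsAdicComplete (Ideal.span {s}) R := by
  have hle : Ideal.span {s} ≤ I := (Ideal.span_singleton_le_iff_mem I).2 hs
  refine { toIsHausdorff := ⟨fun x hx => haus_mem h.toIsHausdorff x fun m => ?_⟩,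
           toIsPrecomplete := prec_of_seq fun f hf => ?_ }
  · have := hx m
    rw [SModEq.zero, smul_eq_mul, Ideal.mul_top] at this
    exact Ideal.pow_right_mono hle m this
  · have : ∀ m, ∃ y, f (m + 1) - f m = s ^ m * y := by
      intro m
      have := hf m (m + 1) (by omega)
      rwa [Ideal.span_singleton_pow, Ideal.mem_span_singleton] at this
    choose y hy using this
    obtain ⟨x, hx, -⟩ := geom_sum h hs y
    refine ⟨f 0 + x 0, fun m => ?_⟩
    rw [Ideal.span_singleton_pow, Ideal.mem_span_singleton]
    refine ⟨x m, ?_⟩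
    induction m with
    | zero => simp
    | succ m ih => linear_combination ih - hy m + s ^ m * hx m

/-- Let `S` be a commutative ring and `s₁, …, sₙ ∈ S` a regular
sequence, generating the ideal `I = (s₁, …, sₙ)`.  Then `S` is `I`-adically complete
if and only if `S` is `sᵢ`-adically complete for every `i = 1, …, n`. -/
theorem adic_complete_iff_single_adic_complete_of_regular_sequence
    {S : Type*} [CommRing S] {n : ℕ} (s : Fin n → S)
    (hreg : RingTheory.Sequence.IsWeaklyRegular S (List.ofFn s)) :
    IsAdicComplete (Ideal.span (Set.range s)) S ↔
      ∀ i : Fin n, IsAdicComplete (Ideal.span {s i}) S := by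
  have hI : Ideal.span (Set.range s) = Ideal.ofList (List.ofFn s) := by
    congr 1
    ext x
    simp [List.mem_ofFn]
  constructor
  · intro h i
    exact complete_single h (Ideal.subset_span ⟨i, rfl⟩)
  · intro h
    rw [hI]
    have hl : ∀ r ∈ List.ofFn s, IsAdicComplete (Ideal.span {r}) S := by
      intro r hr
      obtain ⟨i, rfl⟩ := List.mem_ofFn.1 hr
      exact h i
    refine { toIsHausdorff := ⟨fun x hx => ?_⟩,
             toIsPrecomplete := prec_list _ fun r hr => (hl r hr).toIsPrecomplete }
    exact sep_list _ hreg (fun r hr => dcomp_of_complete (hl r hr)) x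
      fun k => SModEq.zero.1 (hx k)
end

section
/- Let R be a commutative ring and 𝔪 ⊆ R an ideal with 𝔪·𝔪 = 𝔪. For each t ∈ ℕ let 0 → M_{t,1} →^{φₜ} M_{t,2} →^{ψₜ} M_{t,3} be a complex of R-modules (each φₜ, ψₜ is R-linear and ψₜ ∘ φₜ = 0), together with R-linear transition maps ωₜ : M_{t,i} → M_{t−1,i} for t ≥ 1 and i = 1,2,3, commuting with the φ's and ψ's in the obvious sense. Assume that each complex is almost exact: for every t ∈ ℕ and every x ∈ 𝔪, one has x·m = 0 for all m ∈ ker φₜ, and x·m ∈ im φₜ for all m ∈ ker ψₜ. Then the inverse limit complex is almost exact: (a) for every x ∈ 𝔪 and every ω-compatible family (mₜ)ₜ with φₜ(mₜ) = 0 for all t, one has x·mₜ = 0 for all t; (b) for every x ∈ 𝔪 and every ω-compatible family (mₜ)ₜ with ψₜ(mₜ) = 0 for all t, there exists an ω-compatible family (nₜ)ₜ with φₜ(nₜ) = x·mₜ for all t. -/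
/-- (Almost exactness passes to inverse limits.)
Let `R` be a commutative ring and `𝔪 ⊆ R` an ideal with `𝔪·𝔪 = 𝔪`.  For each `t ∈ ℕ`
let `0 → M₁ t →(φ t) M₂ t →(ψ t) M₃ t` be a complex of `R`-modules, together with
transition maps `ωᵢ t : Mᵢ (t+1) → Mᵢ t` commuting with `φ` and `ψ`.  If each complex is
almost exact (its kernels are almost killed by `𝔪`, and almost-cycles are almost
boundaries), then the inverse limit complex is almost exact:
(a) any `ω`-compatible family in `ker φ` is killed by every `x ∈ 𝔪`, and
(b) for any `ω`-compatible family `(mₜ)` in `ker ψ` and `x ∈ 𝔪` there is an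
`ω`-compatible family `(nₜ)` with `φ t (n t) = x • m t` for all `t`. -/
theorem almost_exact_of_inverse_limit
    {R : Type*} [CommRing R] (𝔪 : Ideal R) (h𝔪 : 𝔪 * 𝔪 = 𝔪)
    (M₁ M₂ M₃ : ℕ → Type*)
    [∀ t, AddCommGroup (M₁ t)] [∀ t, Module R (M₁ t)]
    [∀ t, AddCommGroup (M₂ t)] [∀ t, Module R (M₂ t)]
    [∀ t, AddCommGroup (M₃ t)] [∀ t, Module R (M₃ t)]
    (φ : ∀ t, M₁ t →ₗ[R] M₂ t) (ψ : ∀ t, M₂ t →ₗ[R] M₃ t)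
    (hcx : ∀ t (m : M₁ t), ψ t (φ t m) = 0)
    (ω₁ : ∀ t, M₁ (t + 1) →ₗ[R] M₁ t)
    (ω₂ : ∀ t, M₂ (t + 1) →ₗ[R] M₂ t)
    (ω₃ : ∀ t, M₃ (t + 1) →ₗ[R] M₃ t)
    (hωφ : ∀ t (m : M₁ (t + 1)), ω₂ t (φ (t + 1) m) = φ t (ω₁ t m))
    (hωψ : ∀ t (m : M₂ (t + 1)), ω₃ t (ψ (t + 1) m) = ψ t (ω₂ t m))
    (hker : ∀ t, ∀ x ∈ 𝔪, ∀ m : M₁ t, φ t m = 0 → x • m = 0)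
    (hmid : ∀ t, ∀ x ∈ 𝔪, ∀ m : M₂ t, ψ t m = 0 → ∃ n : M₁ t, φ t n = x • m) :
    (∀ x ∈ 𝔪, ∀ m : ∀ t, M₁ t,
        (∀ t, ω₁ t (m (t + 1)) = m t) → (∀ t, φ t (m t) = 0) →
          ∀ t, x • m t = 0) ∧
    (∀ x ∈ 𝔪, ∀ m : ∀ t, M₂ t,
        (∀ t, ω₂ t (m (t + 1)) = m t) → (∀ t, ψ t (m t) = 0) →
          ∃ n : ∀ t, M₁ t,
            (∀ t, ω₁ t (n (t + 1)) = n t) ∧ ∀ t, φ t (n t) = x • m t) := by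
  refine ⟨fun x hx m _ h t => hker t x hx _ (h t), ?_⟩
  intro x hx m hm hψ
  rw [← h𝔪] at hx
  induction hx using Submodule.mul_induction_on' with
  | mem_mul_mem a ha b hb =>
    choose n hn using fun t => hmid t b hb (m t) (hψ t)
    refine ⟨fun t => a • n t, fun t => ?_, fun t => ?_⟩
    · have h : φ t (ω₁ t (n (t + 1)) - n t) = 0 := by
        rw [map_sub, ← hωφ, hn, hn, map_smul, hm, sub_self]
      have h2 := hker t a ha _ h
      rw [smul_sub, sub_eq_zero] at h2
      rw [map_smul, h2]
    · rw [map_smul, hn, mul_smul]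
  | add x _ y _ ihx ihy =>
    obtain ⟨n, hn, hn'⟩ := ihx
    obtain ⟨k, hk, hk'⟩ := ihy
    exact ⟨fun t => n t + k t, fun t => by rw [map_add, hn, hk],
      fun t => by rw [map_add, hn', hk', add_smul]⟩
end

section
/- Let R be a commutative ring, 𝔪 ⊆ R an ideal, and r ∈ 𝔪. Let M₁ →^{f} M₂ →^{g} M₃ be a complex of R-modules (g ∘ f = 0) such that multiplication by r is bijective on M₁, M₂ and M₃. If the complex is almost exact with respect to 𝔪, i.e. x·m = 0 for all x ∈ 𝔪 and m ∈ ker f, and x·m ∈ im f for all x ∈ 𝔪 and m ∈ ker g, then the complex is exact: f is injective and ker g = im f. -/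
/-- Let `R` be a commutative ring, `𝔪 ⊆ R` an ideal and `r ∈ 𝔪`.
Let `M₁ →(f) M₂ →(g) M₃` be a complex of `R`-modules on which multiplication by `r`
is bijective.  If the complex is almost exact with respect to `𝔪`, then it is exact:
`f` is injective and `ker g = im f`. -/
theorem exact_of_almost_exact_of_smul_bijective
    {R : Type*} [CommRing R] (𝔪 : Ideal R) (r : R) (hr : r ∈ 𝔪)
    {M₁ M₂ M₃ : Type*}
    [AddCommGroup M₁] [Module R M₁]
    [AddCommGroup M₂] [Module R M₂]
    [AddCommGroup M₃] [Module R M₃]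
    (f : M₁ →ₗ[R] M₂) (g : M₂ →ₗ[R] M₃)
    (hgf : ∀ m : M₁, g (f m) = 0)
    (hr₁ : Function.Bijective fun m : M₁ => r • m)
    (hr₂ : Function.Bijective fun m : M₂ => r • m)
    (hr₃ : Function.Bijective fun m : M₃ => r • m)
    (hker : ∀ x ∈ 𝔪, ∀ m : M₁, f m = 0 → x • m = 0)
    (hmid : ∀ x ∈ 𝔪, ∀ m : M₂, g m = 0 → ∃ n : M₁, f n = x • m) :
    Function.Injective f ∧ LinearMap.ker g = LinearMap.range f := by
  refine ⟨?_, ?_⟩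
  · rw [injective_iff_map_eq_zero]
    intro m hm
    apply hr₁.1
    simpa using hker r hr m hm
  · apply le_antisymm
    · intro m hm
      obtain ⟨n, hn⟩ := hmid r hr m hm
      obtain ⟨k, hk⟩ := hr₁.2 n
      refine ⟨k, hr₂.1 ?_⟩
      change r • f k = r • m
      rw [← map_smul, ← hn]
      exact congrArg f hk
    · rintro _ ⟨n, rfl⟩
      exact hgf n
end

section
/- Let A be a commutative ring and let p, ξ ∈ A be such that p is a non-zero-divisor and for every h ∈ A, if p divides h·ξ then p divides h. Fix m ∈ ℕ. Then the kernel of the A-algebra homomorphism A[ζ] → A[1/p] from the polynomial ring in one variable to the localization of A at p, sending ζ to ξ/p^m, is exactly the ideal of A[ζ] generated by the polynomial p^m·ζ − ξ. -/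
open Polynomial in
theorem ker_aux {A S : Type*} [CommRing A] [CommRing S] [Algebra A S]
    (hinj : Function.Injective (algebraMap A S)) (q ξ : A) (x : S)
    (hx : algebraMap A S q * x = algebraMap A S ξ)
    (hq : ∀ h : A, q ∣ h * ξ → q ∣ h) (n : ℕ) :
    ∀ f : A[X], f.natDegree ≤ n → aeval x f = 0 → f ∈ Ideal.span {C q * X - C ξ} := by
  have hqn : ∀ (k : ℕ) (h : A), q ∣ h * ξ ^ k → q ∣ h := by
    intro k
    induction k with
    | zero => intro h hh; simpa using hh
    | succ k ih =>
      intro h hh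
      exact ih h (hq _ (by rwa [mul_assoc, ← pow_succ]))
  induction n with
  | zero =>
    intro f hf h0
    rw [eq_C_of_natDegree_le_zero hf, aeval_C] at h0
    rw [eq_C_of_natDegree_le_zero hf, hinj (h0.trans (map_zero _).symm)]
    simp
  | succ n ih =>
    intro f hf h0
    have hdvd : q ∣ f.coeff (n + 1) := by
      apply hqn (n + 1)
      have key : f.coeff (n + 1) * ξ ^ (n + 1)
          + q * ∑ i ∈ Finset.range (n + 1), f.coeff i * ξ ^ i * q ^ (n - i) = 0 := by
        apply hinj
        have h1 := h0
        rw [aeval_eq_sum_range' (Nat.lt_succ_of_le hf), Finset.sum_range_succ] at h1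
        have h2 := congrArg (fun t => algebraMap A S q ^ (n + 1) * t) h1
        simp only [mul_add, mul_zero, Finset.mul_sum, Algebra.smul_def] at h2
        rw [map_zero, ← h2, add_comm]
        simp only [map_add, map_mul, map_sum, map_pow, Finset.mul_sum, ← hx]
        congr 1
        · apply Finset.sum_congr rfl
          intro i hi
          have : n + 1 = i + (n - i) + 1 := by
            have := Finset.mem_range.1 hi
            omega
          rw [this, pow_succ, pow_add]
          ring
        · ring
      exact (dvd_add_left (dvd_mul_right _ _)).1 (key ▸ dvd_zero q)
    obtain ⟨b, hb⟩ := hdvd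
    have hmem : C b * X ^ n * (C q * X - C ξ) ∈ Ideal.span {C q * X - C ξ} :=
      Ideal.mul_mem_left _ _ (Ideal.subset_span rfl)
    have hg := ih (f - C b * X ^ n * (C q * X - C ξ)) ?_ ?_
    · simpa using Ideal.add_mem _ hg hmem
    · have e : C b * X ^ n * (C q * X - C ξ) = C (q * b) * X ^ (n + 1) - C (b * ξ) * X ^ n := by
        simp only [C_mul]; ring
      rw [e, natDegree_le_iff_coeff_eq_zero]
      intro N hN
      simp only [coeff_sub, coeff_C_mul_X_pow]
      rcases eq_or_ne N (n + 1) with rfl | hne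
      · simp [hb]
      · rw [coeff_eq_zero_of_natDegree_lt (by omega), if_neg hne, if_neg (by omega)]
        simp
    · simp [h0, hx]

/-- Let `A` be a commutative ring and `p, ξ ∈ A` with `p` a
non-zero-divisor such that `p ∣ h·ξ` implies `p ∣ h`.  For `m ∈ ℕ`, the kernel of the
`A`-algebra map `A[ζ] → A[1/p]`, `ζ ↦ ξ/pᵐ`, is exactly the ideal generated by
`pᵐ·ζ − ξ`. -/
theorem ker_aeval_localization_eq_span
    {A : Type*} [CommRing A] (p ξ : A) (hp : p ∈ nonZeroDivisors A)
    (hdvd : ∀ h : A, p ∣ h * ξ → p ∣ h) (m : ℕ) :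
    RingHom.ker
        (Polynomial.aeval
          (algebraMap A (Localization.Away p) ξ *
            (IsLocalization.Away.invSelf (S := Localization.Away p) p) ^ m) :
          Polynomial A →ₐ[A] Localization.Away p) =
      Ideal.span {Polynomial.C (p ^ m) * Polynomial.X - Polynomial.C ξ} := by

  have hx : algebraMap A (Localization.Away p) (p ^ m) * (algebraMap A (Localization.Away p) ξ *
      (IsLocalization.Away.invSelf (S := Localization.Away p) p) ^ m)
      = algebraMap A (Localization.Away p) ξ := by
    rw [map_pow, mul_left_comm, ← mul_pow, IsLocalization.Away.mul_invSelf, one_pow, mul_one]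
  have hinj : Function.Injective (algebraMap A (Localization.Away p)) :=
    IsLocalization.injective _ (Submonoid.powers_le.2 hp)
  have hq : ∀ (k : ℕ) (h : A), p ^ k ∣ h * ξ → p ^ k ∣ h := by
    intro k
    induction k with
    | zero => intro h _; simp
    | succ k ih =>
      intro h hh
      obtain ⟨h', rfl⟩ := hdvd h ((Dvd.intro_left _ (pow_succ p k).symm).trans hh)
      obtain ⟨c, hc⟩ := hh
      have h3 : h' * ξ = p ^ k * c := by
        apply (mul_cancel_left_mem_nonZeroDivisors hp).1
        rw [← mul_assoc, hc]
        ring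
      rw [pow_succ']
      exact mul_dvd_mul_left p (ih h' ⟨c, h3⟩)
  apply le_antisymm
  · intro f hf
    exact ker_aux hinj _ _ _ hx (hq m) _ f le_rfl hf
  · rw [Ideal.span_le, Set.singleton_subset_iff]
    change Polynomial.aeval _ _ = 0
    rw [map_sub, map_mul, Polynomial.aeval_C, Polynomial.aeval_C, Polynomial.aeval_X, hx, sub_self]
end

section
/- Let A be a commutative ring and let p, ξ ∈ A be such that ξ is a non-zero-divisor and for every h ∈ A, if ξ divides h·p then ξ divides h. Then for every s ∈ ℕ and every f ∈ A: if f·ξ belongs to the ideal (p, ξ)^{s+2}, then f belongs to the ideal (p, ξ)^{s+1}. (Equivalently, the (p, ξ)-adic order of f·ξ is exactly one more than that of f.) -/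
theorem decomp_aux {A : Type*} [CommRing A] (p ξ : A) (n : ℕ) :
    ∀ x ∈ (Ideal.span {p, ξ}) ^ (n + 1),
      ∃ a, ∃ g ∈ (Ideal.span {p, ξ}) ^ n, x = a * p ^ (n + 1) + ξ * g := by
  have hp : p ∈ Ideal.span {p, ξ} := Ideal.subset_span (by simp)
  induction n with
  | zero =>
    intro x hx
    rw [zero_add, pow_one, Ideal.mem_span_pair] at hx
    obtain ⟨a, b, rfl⟩ := hx
    exact ⟨a, b, by simp, by ring⟩
  | succ k ih =>
    intro x hx
    rw [pow_succ] at hx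
    induction hx using Submodule.mul_induction_on' with
    | mem_mul_mem m hm y hy =>
      obtain ⟨a, g, hg, rfl⟩ := ih m hm
      obtain ⟨c, d, hcd⟩ := Ideal.mem_span_pair.1 hy
      refine ⟨a * c, d * a * p ^ (k + 1) + g * y, ?_, ?_⟩
      · refine Ideal.add_mem _ (Ideal.mul_mem_left _ _ (Ideal.pow_mem_pow hp _)) ?_
        rw [pow_succ]
        exact Ideal.mul_mem_mul hg hy
      · rw [← hcd]; ring
    | add x _ y _ hx hy =>
      obtain ⟨a, g, hg, rfl⟩ := hx
      obtain ⟨b, h, hh, rfl⟩ := hy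
      exact ⟨a + b, g + h, Ideal.add_mem _ hg hh, by ring⟩

/-- Let `A` be a commutative ring and `p, ξ ∈ A` with `ξ` a
non-zero-divisor such that `ξ ∣ h·p` implies `ξ ∣ h`.  Then for every `s ∈ ℕ` and
`f ∈ A`, if `f·ξ ∈ (p, ξ)^(s+2)` then `f ∈ (p, ξ)^(s+1)`. -/
theorem mem_pow_of_mul_mem_pow_succ
    {A : Type*} [CommRing A] (p ξ : A) (hξ : ξ ∈ nonZeroDivisors A)
    (hdvd : ∀ h : A, ξ ∣ h * p → ξ ∣ h) :
    ∀ (s : ℕ) (f : A),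
      f * ξ ∈ (Ideal.span {p, ξ}) ^ (s + 2) → f ∈ (Ideal.span {p, ξ}) ^ (s + 1) := by
  intro s f hf
  have hp : p ∈ Ideal.span {p, ξ} := Ideal.subset_span (by simp)
  obtain ⟨a, g, hg, h⟩ := decomp_aux p ξ (s + 1) _ hf
  have key : ∀ (n : ℕ) (a : A), ξ ∣ a * p ^ n → ξ ∣ a := by
    intro n
    induction n with
    | zero => intro a h; simpa using h
    | succ k ih =>
      intro a h
      exact ih a (hdvd _ (by rwa [mul_assoc, ← pow_succ]))
  obtain ⟨b, rfl⟩ := key (s + 1 + 1) a ⟨f - g, by linear_combination -h⟩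
  have hfe : f = b * p * p ^ (s + 1) + g := by
    apply (mul_cancel_right_mem_nonZeroDivisors hξ).1
    rw [h]; ring
  rw [hfe]
  exact Ideal.add_mem _ (Ideal.mul_mem_left _ _ (Ideal.pow_mem_pow hp _)) hg
end

section
/- Let A be a commutative ring and let p, ξ ∈ A be such that: ξ is a non-zero-divisor; for every h ∈ A, if ξ divides h·p then ξ divides h; and A/(ξ) is p-adically separated, i.e. ⋂_{n∈ℕ} ((p^n) + (ξ)) ⊆ (ξ). Then for every t ≥ 1 the quotient A/(ξ^t) is p-adically separated: ⋂_{n∈ℕ} ((p^n) + (ξ^t)) ⊆ (ξ^t). -/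
/-- Let `A` be a commutative ring and `p, ξ ∈ A` with `ξ` a
non-zero-divisor such that `ξ ∣ h·p` implies `ξ ∣ h`, and assume `A/(ξ)` is
`p`-adically separated, i.e. `⋂ₙ ((pⁿ) + (ξ)) ⊆ (ξ)`.  Then for every `t ≥ 1` the
quotient `A/(ξᵗ)` is `p`-adically separated: `⋂ₙ ((pⁿ) + (ξᵗ)) ⊆ (ξᵗ)`. -/
theorem quotient_pow_p_adically_separated
    {A : Type*} [CommRing A] (p ξ : A) (hξ : ξ ∈ nonZeroDivisors A)
    (hdvd : ∀ h : A, ξ ∣ h * p → ξ ∣ h)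
    (hsep : (⨅ n : ℕ, (Ideal.span {p ^ n} + Ideal.span {ξ})) ≤ Ideal.span {ξ}) :
    ∀ t : ℕ, 1 ≤ t →
      (⨅ n : ℕ, (Ideal.span {p ^ n} + Ideal.span {ξ ^ t})) ≤ Ideal.span {ξ ^ t} := by
  have key : ∀ (n : ℕ) (a : A), ξ ∣ a * p ^ n → ξ ∣ a := by
    intro n
    induction n with
    | zero => intro a h; simpa using h
    | succ n ih =>
      intro a h
      apply ih
      apply hdvd
      rwa [mul_assoc, ← pow_succ]
  have mem : ∀ (x : A) (n t : ℕ), x ∈ Ideal.span {p ^ n} + Ideal.span {ξ ^ t} ↔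
      ∃ a b : A, a * p ^ n + ξ ^ t * b = x := by
    intro x n t
    rw [Submodule.add_eq_sup, Ideal.mem_span_singleton_sup]
    constructor
    · rintro ⟨a, c, hc, h⟩
      obtain ⟨b, rfl⟩ := Ideal.mem_span_singleton.1 hc
      exact ⟨a, b, h⟩
    · rintro ⟨a, b, h⟩
      exact ⟨a, ξ ^ t * b, Ideal.mem_span_singleton.2 ⟨b, rfl⟩, h⟩
  have main : ∀ (t : ℕ) (x : A), (∀ n : ℕ, ∃ a b : A, a * p ^ n + ξ ^ t * b = x) →
      ξ ^ t ∣ x := by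
    intro t
    induction t with
    | zero => intro x _; simp
    | succ t ih =>
      intro x hx
      have h1 : x ∈ Ideal.span {ξ} := by
        apply hsep
        rw [Submodule.mem_iInf]
        intro n
        obtain ⟨a, b, h⟩ := hx n
        have := (mem x n 1).2 ⟨a, ξ ^ t * b, by rw [← h]; ring⟩
        simpa using this
      obtain ⟨y, rfl⟩ := Ideal.mem_span_singleton.1 h1
      rw [pow_succ']
      apply mul_dvd_mul_left
      apply ih
      intro n
      obtain ⟨a, b, h⟩ := hx n
      obtain ⟨c, rfl⟩ := key n a ⟨y - ξ ^ t * b, by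
        rw [mul_sub, ← h]; ring⟩
      refine ⟨c, b, ?_⟩
      apply (mul_cancel_left_mem_nonZeroDivisors hξ).1
      rw [← h]; ring
  intro t _ x hx
  rw [Submodule.mem_iInf] at hx
  exact Ideal.mem_span_singleton.2 (main t x fun n => (mem x n t).1 (hx n))
end
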